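/- Let A be a tabular J-algebra and let v, w ∈ A with v·w = v and v ≠ w. Then there exist a set U and a function ρ from A to the set of binary relations on U such that ρ(v) ≠ ρ(w), ρ(0) = ∅, and for all x, y ∈ A: ρ(x·y) = ρ(x) ∩ ρ(y), ρ(x;y) = ρ(x)|ρ(y) (relational composition), and ρ(x˘) is the converse relation of ρ(x). -/

import Mathlib

/-- A J-algebra: an algebra (A, ·, 0, 1, ;, ˘, 1') satisfying Jónsson's axioms. -/
structure JAlgebra (A : Type*) where
  meet : A → A → A        -- Boolean product ·
  comp : A → A → A        -- relative product ;
  conv : A → A            -- converse ˘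
  zero : A                -- 0
  one : A                 -- 1
  ident : A               -- 1'
  massoc : ∀ x y z, meet x (meet y z) = meet (meet x y) z
  mcomm : ∀ x y, meet x y = meet y x
  midem : ∀ x, meet x x = x
  cassoc : ∀ x y z, comp x (comp y z) = comp (comp x y) z
  cid : ∀ x, comp x ident = x
  semidist : ∀ x y z, comp (meet x y) z = meet (comp (meet x y) z) (comp y z)
  convconv : ∀ x, conv (conv x) = x
  convcomp : ∀ x y, conv (comp x y) = comp (conv y) (conv x)
  convmeet : ∀ x y, conv (meet x y) = meet (conv x) (conv y)
  rot : ∀ x y z, meet (comp x y) z =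
    meet (comp (meet (comp z (conv y)) x) (meet y (comp (conv x) z))) z
  zbot : ∀ x, meet zero x = zero
  otop : ∀ x, meet x one = x
  comp_zero : ∀ x, comp x zero = zero

/-- x ≤ y iff x·y = x. -/
def JAlgebra.le {A : Type*} (J : JAlgebra A) (x y : A) : Prop := J.meet x y = x

/-- x is functional iff x˘;x ≤ 1'. -/
def JAlgebra.Functional {A : Type*} (J : JAlgebra A) (x : A) : Prop :=
  J.le (J.comp (J.conv x) x) J.ident

/-- x is permutational iff x;x˘ = 1' = x˘;x. -/
def JAlgebra.Permutational {A : Type*} (J : JAlgebra A) (x : A) : Prop :=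
  J.comp x (J.conv x) = J.ident ∧ J.comp (J.conv x) x = J.ident

/-- A J-algebra is tabular if for all v < w there are functional p, q with
0 ≠ p˘;q ≤ w and v·(p˘;q) = 0. -/
def JAlgebra.Tabular {A : Type*} (J : JAlgebra A) : Prop :=
  ∀ v w : A, J.meet v w = v → v ≠ w →
    ∃ p q : A, J.Functional p ∧ J.Functional q ∧
      J.comp (J.conv p) q ≠ J.zero ∧
      J.le (J.comp (J.conv p) q) w ∧
      J.meet v (J.comp (J.conv p) q) = J.zero

universe u

namespace JAlgebra

variable {A : Type u} {J : JAlgebra A}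

section Laws

variable {x y z : A}

theorem le.trans (hxy : J.le x y) (hyz : J.le y z) : J.le x z := by
  unfold le at *
  rw [← hxy, ← J.massoc, hyz]

theorem le.antisymm (hxy : J.le x y) (hyx : J.le y x) : x = y := by
  unfold le at *
  rw [← hxy, J.mcomm, hyx]

theorem meet_le_left (x y : A) : J.le (J.meet x y) x := by
  rw [le, J.mcomm, J.massoc, J.midem]

theorem meet_le_right (x y : A) : J.le (J.meet x y) y := by
  rw [le, ← J.massoc, J.midem]

theorem le_meet (hxy : J.le x y) (hxz : J.le x z) : J.le x (J.meet y z) := by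
  unfold le at *
  rw [J.massoc, hxy, hxz]

theorem le.conv (h : J.le x y) : J.le (J.conv x) (J.conv y) := by
  unfold le at *
  rw [← J.convmeet, h]

theorem le.comp_right (h : J.le x y) (z : A) : J.le (J.comp x z) (J.comp y z) := by
  have := J.semidist x y z
  rw [le] at *
  rw [h] at this
  exact this.symm

theorem conv_ident : J.conv J.ident = J.ident := by
  rw [← J.cid (J.conv J.ident)]
  conv_rhs => rw [← J.convconv J.ident, ← J.cid (J.conv J.ident), J.convcomp, J.convconv]

theorem ident_comp (x : A) : J.comp J.ident x = x := by
  rw [← J.convconv (J.comp J.ident x), J.convcomp, conv_ident, J.cid, J.convconv]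

theorem conv_zero : J.conv J.zero = J.zero := by
  rw [← J.zbot (J.conv J.zero), J.convmeet, J.convconv, J.mcomm]

theorem zero_comp (x : A) : J.comp J.zero x = J.zero := by
  rw [← J.convconv (J.comp J.zero x), J.convcomp, conv_zero, J.comp_zero, conv_zero]

end Laws

/-- The underlying set of a J-algebra, as a type synonym that carries the order and the
involutive monoid structure. -/
def Carrier {A : Type u} (_ : JAlgebra A) : Type u := A

instance : SemilatticeInf J.Carrier where
  le := J.le
  le_refl := J.midem
  le_trans _ _ _ := le.trans
  le_antisymm _ _ := le.antisymm
  inf := J.meet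
  inf_le_left := meet_le_left
  inf_le_right := meet_le_right
  le_inf _ _ _ := le_meet

instance : MonoidWithZero J.Carrier where
  mul := J.comp
  one := J.ident
  zero := J.zero
  mul_assoc x y z := (J.cassoc x y z).symm
  mul_one := J.cid
  one_mul := ident_comp
  mul_zero := J.comp_zero
  zero_mul := zero_comp

instance : StarMul J.Carrier where
  star := J.conv
  star_involutive := J.convconv
  star_mul := J.convcomp

variable {x y z e f g q r : J.Carrier}

theorem zero_le (x : J.Carrier) : 0 ≤ x := J.zbot x

theorem eq_zero_of_le (h : x ≤ 0) : x = 0 := le_antisymm h (zero_le x)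

theorem star_le_star (h : x ≤ y) : star x ≤ star y :=
  le.conv h

theorem star_le_one (h : x ≤ 1) : star x ≤ 1 := by
  simpa using star_le_star h

instance : MulRightMono J.Carrier := ⟨fun z _ _ h => le.comp_right h z⟩

instance : MulLeftMono J.Carrier := ⟨fun z x y h => by
  have h' : star x * star z ≤ star y * star z := le.comp_right (star_le_star h) _
  simpa using star_le_star h'⟩

theorem star_zero_eq : star (0 : J.Carrier) = 0 :=
  conv_zero

theorem rotate (x y z : J.Carrier) :
    x * y ⊓ z = (z * star y ⊓ x) * (y ⊓ star x * z) ⊓ z :=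
  J.rot x y z

theorem mul_inf_le_mul_right (x y z : J.Carrier) : x * y ⊓ z ≤ x * (y ⊓ star x * z) := by
  rw [rotate]
  exact inf_le_left.trans (mul_le_mul' inf_le_right le_rfl)

theorem mul_inf_le_mul_left (x y z : J.Carrier) : x * y ⊓ z ≤ (x ⊓ z * star y) * y := by
  rw [rotate, inf_comm x]
  exact inf_le_left.trans (mul_le_mul' le_rfl inf_le_left)

theorem le_mul_self_of_le_one (he : e ≤ 1) : e ≤ e * e := by
  have h := mul_inf_le_mul_right e 1 e
  rw [mul_one, inf_idem] at h
  refine h.trans (mul_le_mul' le_rfl (inf_le_right.trans ?_))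
  simpa using mul_le_mul' (star_le_one he) (le_refl e)

theorem le_star_of_le_one (he : e ≤ 1) : e ≤ star e := by
  have h := mul_inf_le_mul_right e 1 e
  rw [mul_one, inf_idem] at h
  have h' : e ≤ 1 * (1 ⊓ star e * e) := h.trans (mul_le_mul' he le_rfl)
  rw [one_mul] at h'
  exact (h'.trans inf_le_right).trans (by simpa using mul_le_mul' (le_refl (star e)) he)

theorem le_mul_of_le_mul (he : e ≤ 1) (h : x ≤ e * y) : x ≤ e * x := by
  have h' := mul_inf_le_mul_right e y x
  rw [inf_eq_right.2 h] at h'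
  refine h'.trans (mul_le_mul' le_rfl (inf_le_right.trans ?_))
  simpa using mul_le_mul' (star_le_one he) (le_refl x)

theorem mul_inf_mul_le (hf : star f * f ≤ 1) (x y : J.Carrier) :
    f * x ⊓ f * y ≤ f * (x ⊓ y) := by
  refine (mul_inf_le_mul_right f x (f * y)).trans
    (mul_le_mul' le_rfl (inf_le_inf_left x ?_))
  rw [← mul_assoc]
  simpa using mul_le_mul' hf (le_refl y)

theorem mul_star_inf_mul_star_le (hg : star g * g ≤ 1) (x y : J.Carrier) :
    x * star g ⊓ y * star g ≤ (x ⊓ y) * star g := by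
  refine (mul_inf_le_mul_left x (star g) (y * star g)).trans
    (mul_le_mul' (inf_le_inf_left x ?_) le_rfl)
  rw [star_star, mul_assoc]
  simpa using mul_le_mul' (le_refl y) hg

theorem conjugate_inf_le (hf : star f * f ≤ 1) (hg : star g * g ≤ 1) (x y : J.Carrier) :
    f * x * star g ⊓ f * y * star g ≤ f * (x ⊓ y) * star g :=
  (mul_star_inf_mul_star_le hg _ _).trans (mul_le_mul' (mul_inf_mul_le hf x y) le_rfl)

theorem functional_mul (hf : star f * f ≤ 1) (hg : star g * g ≤ 1) :
    star (f * g) * (f * g) ≤ 1 := by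
  calc star (f * g) * (f * g) = star g * (star f * f) * g := by simp only [star_mul, mul_assoc]
    _ ≤ star g * 1 * g := by gcongr
    _ ≤ 1 := by simpa using hg

/-- The identity on the common domain of `r` and `q`. -/
def overlap (r q : J.Carrier) : J.Carrier := 1 ⊓ (r * star r ⊓ q * star q)

theorem overlap_le_one : overlap r q ≤ 1 := inf_le_left

theorem overlap_le_left : overlap r q ≤ r * star r := inf_le_right.trans inf_le_left

theorem overlap_le_right : overlap r q ≤ q * star q := inf_le_right.trans inf_le_right

theorem overlap_ne_zero (h : star r * q ≠ 0) : overlap r q ≠ 0 := by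
  intro h0
  apply h
  apply eq_zero_of_le
  have hr : star r ≤ star r * (1 ⊓ r * star r) := by
    simpa using mul_inf_le_mul_right (star r) 1 (star r)
  have hq : q ≤ (1 ⊓ q * star q) * q := by
    simpa using mul_inf_le_mul_left 1 q q
  have hd : (1 ⊓ r * star r) * (1 ⊓ q * star q) ≤ overlap r q := by
    have h₁ : (1 ⊓ r * star r) * (1 ⊓ q * star q) ≤ 1 ⊓ r * star r := by
      simpa using mul_le_mul' (le_refl (1 ⊓ r * star r)) (inf_le_left : 1 ⊓ q * star q ≤ 1)
    have h₂ : (1 ⊓ r * star r) * (1 ⊓ q * star q) ≤ 1 ⊓ q * star q := by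
      simpa using mul_le_mul' (inf_le_left : 1 ⊓ r * star r ≤ 1) (le_refl (1 ⊓ q * star q))
    exact le_inf (h₁.trans inf_le_left)
      (le_inf (h₁.trans inf_le_right) (h₂.trans inf_le_right))
  calc star r * q ≤ star r * (1 ⊓ r * star r) * ((1 ⊓ q * star q) * q) := mul_le_mul' hr hq
    _ = star r * ((1 ⊓ r * star r) * (1 ⊓ q * star q)) * q := by simp only [mul_assoc]
    _ ≤ star r * overlap r q * q := by gcongr
    _ = 0 := by rw [h0, mul_zero, zero_mul]

theorem overlap_le_of_le (h : star r * q ≤ x) : overlap r q ≤ r * x * star q := by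
  calc overlap r q ≤ overlap r q * overlap r q := le_mul_self_of_le_one overlap_le_one
    _ ≤ (r * star r) * (q * star q) := mul_le_mul' overlap_le_left overlap_le_right
    _ = r * (star r * q) * star q := by simp only [mul_assoc]
    _ ≤ r * x * star q := by gcongr

theorem overlap_comm (r q : J.Carrier) : overlap r q = overlap q r := by
  rw [overlap, overlap, inf_comm (r * star r)]

theorem overlap_le_of_le_star (h : star r * q ≤ star x) : overlap r q ≤ q * x * star r := by
  rw [overlap_comm]
  exact overlap_le_of_le (by simpa using star_le_star h)

theorem overlap_le_conjugate (he : e ≤ 1) (h : star r * q ≤ e * x) :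
    overlap r q ≤ r * e * star r := by
  have h' : star r * overlap r q ≤ e * (star r * overlap r q) := by
    apply le_mul_of_le_mul he (y := x * star q)
    calc star r * overlap r q ≤ star r * (q * star q) := by gcongr; exact overlap_le_right
      _ = star r * q * star q := (mul_assoc _ _ _).symm
      _ ≤ e * x * star q := by gcongr
      _ = e * (x * star q) := mul_assoc _ _ _
  calc overlap r q ≤ overlap r q * overlap r q := le_mul_self_of_le_one overlap_le_one
    _ ≤ r * star r * overlap r q := by gcongr; exact overlap_le_left
    _ = r * (star r * overlap r q) := mul_assoc _ _ _
    _ ≤ r * (e * (star r * overlap r q)) := by gcongr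
    _ ≤ r * (e * (star r * 1)) := by gcongr; exact overlap_le_one
    _ = r * e * star r := by simp only [mul_one, mul_assoc]

theorem overlap_inf_eq_zero (h : x ⊓ star r * q = 0) : overlap r q ⊓ r * x * star q = 0 := by
  apply eq_zero_of_le
  calc overlap r q ⊓ r * x * star q = r * (x * star q) ⊓ overlap r q := by
        rw [inf_comm, mul_assoc]
    _ ≤ r * (x * star q ⊓ star r * overlap r q) := mul_inf_le_mul_right _ _ _
    _ ≤ r * (x * star q ⊓ star r * 1) := by gcongr; exact overlap_le_one
    _ ≤ r * ((x ⊓ star r * 1 * star (star q)) * star q) := by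
        gcongr; exact mul_inf_le_mul_left _ _ _
    _ = 0 := by rw [star_star, mul_one, h, zero_mul, mul_zero]

theorem mul_inf_ne_zero (he : e ≤ 1) (he0 : e ≠ 0) (h : e ≤ x * star y) :
    e * (x ⊓ y) ≠ 0 := by
  intro h0
  apply he0
  apply eq_zero_of_le
  have hxy : x ⊓ e * y ≤ e * (x ⊓ y) := by
    rw [inf_comm, inf_comm x]
    refine (mul_inf_le_mul_right e y x).trans (mul_le_mul' le_rfl (inf_le_inf_left y ?_))
    simpa using mul_le_mul' (star_le_one he) (le_refl x)
  calc e = x * star y ⊓ e := (inf_eq_right.2 h).symm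
    _ ≤ (x ⊓ e * star (star y)) * star y := mul_inf_le_mul_left _ _ _
    _ ≤ e * (x ⊓ y) * star y := by rw [star_star]; gcongr
    _ = 0 := by rw [h0, zero_mul]

/-- Names for points: two initial points, and a witness for every instance of a
relative product. -/
inductive PointName (A : Type u) : Type u
  | source : PointName A
  | target : PointName A
  | witness (a b : PointName A) (x y : A) : PointName A

/-- A forcing condition: partially defined functional elements interpreting the names
over a nonzero subidentity element `base`; the value `0` marks names not yet interpreted. -/
structure Condition (J : JAlgebra A) (v w : J.Carrier) where
  base : J.Carrier
  val : PointName A → J.Carrier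
  base_ne_zero : base ≠ 0
  base_le_one : base ≤ 1
  functional : ∀ a, star (val a) * val a ≤ 1
  le_upper : base ≤ val .source * w * star (val .target)
  disjoint_lower : base ⊓ val .source * v * star (val .target) = 0
  le_witness : ∀ a b (x y : J.Carrier), val (.witness a b x y) ≠ 0 →
    base ≤ val a * x * star (val (.witness a b x y)) ∧
      base ≤ val (.witness a b x y) * y * star (val b)

namespace Condition

variable {v w : J.Carrier} {p : Condition J v w} {a b : PointName A}

/-- The condition `p` forces the pair `(a, b)` to belong to the relation `x`. -/
def Forces (p : Condition J v w) (a b : PointName A) (x : J.Carrier) : Prop :=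
  p.base ≤ p.val a * x * star (p.val b)

theorem Forces.left_ne_zero (h : p.Forces a b x) : p.val a ≠ 0 := fun h0 =>
  p.base_ne_zero (eq_zero_of_le (by simpa [Forces, h0] using h))

theorem Forces.right_ne_zero (h : p.Forces a b x) : p.val b ≠ 0 := fun h0 =>
  p.base_ne_zero (eq_zero_of_le (by simpa [Forces, h0, star_zero_eq] using h))

theorem not_forces_zero : ¬ p.Forces a b 0 := fun h =>
  p.base_ne_zero (eq_zero_of_le (by simpa [Forces] using h))

theorem not_forces_lower : ¬ p.Forces .source .target v := fun h =>
  p.base_ne_zero ((inf_eq_left.2 h).symm.trans p.disjoint_lower)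

theorem Forces.mono (h : p.Forces a b x) (hxy : x ≤ y) : p.Forces a b y :=
  h.trans (by gcongr)

theorem Forces.inf (hx : p.Forces a b x) (hy : p.Forces a b y) : p.Forces a b (x ⊓ y) :=
  (le_inf hx hy).trans (conjugate_inf_le (p.functional a) (p.functional b) x y)

theorem Forces.mul {c : PointName A} (hx : p.Forces a c x) (hy : p.Forces c b y) :
    p.Forces a b (x * y) := by
  calc p.base ≤ p.base * p.base := le_mul_self_of_le_one p.base_le_one
    _ ≤ (p.val a * x * star (p.val c)) * (p.val c * y * star (p.val b)) := mul_le_mul' hx hy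
    _ = p.val a * x * (star (p.val c) * p.val c) * y * star (p.val b) := by
        simp only [mul_assoc]
    _ ≤ p.val a * x * 1 * y * star (p.val b) := by gcongr; exact p.functional c
    _ = p.val a * (x * y) * star (p.val b) := by simp only [mul_one, mul_assoc]

theorem Forces.star (h : p.Forces a b x) : p.Forces b a (star x) := by
  calc p.base ≤ Star.star p.base := le_star_of_le_one p.base_le_one
    _ ≤ Star.star (p.val a * x * Star.star (p.val b)) := star_le_star h
    _ = p.val b * Star.star x * Star.star (p.val a) := by
        simp only [star_mul, star_star, mul_assoc]

/-- One condition refines another if it forces at least as much. -/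
instance : Preorder (Condition J v w) where
  le p' p := ∀ a b x, p.Forces a b x → p'.Forces a b x
  le_refl _ _ _ _ h := h
  le_trans _ _ _ h h' a b x hx := h a b x (h' a b x hx)

open Classical in
theorem exists_le_forces_witness (hTab : J.Tabular) (p : Condition J v w)
    (h : p.Forces a b (x * y)) :
    ∃ p' ≤ p, p'.Forces a (.witness a b x y) x ∧ p'.Forces (.witness a b x y) b y := by
  set c : PointName A := .witness a b x y with hc
  by_cases hc0 : p.val c ≠ 0
  · exact ⟨p, le_rfl, p.le_witness a b x y hc0⟩
  rw [not_not] at hc0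
  set u := p.val a * x ⊓ p.val b * star y
  have hu : p.base * u ≠ 0 := by
    apply mul_inf_ne_zero p.base_le_one p.base_ne_zero
    simpa [Forces, mul_assoc] using h
  obtain ⟨r, q, hr, hq, hne, hle, -⟩ := hTab J.zero (p.base * u) (J.zbot _) (Ne.symm hu)
  change J.Carrier at r q
  change star r * r ≤ 1 at hr
  change star q * q ≤ 1 at hq
  change star r * q ≠ 0 at hne
  change star r * q ≤ p.base * u at hle
  have hle' : star r * q ≤ u := hle.trans (by simpa using mul_le_mul' p.base_le_one (le_refl u))
  set val : PointName A → J.Carrier := Function.update (fun d => r * p.val d) c q with hval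
  have hval_self : val c = q := Function.update_self ..
  have hval_ne : ∀ {d}, p.val d ≠ 0 → val d = r * p.val d := fun hd =>
    Function.update_of_ne (fun hdc => hd (by rw [hdc, hc0])) ..
  have hbase : overlap r q ≤ r * p.base * star r := overlap_le_conjugate p.base_le_one hle
  have hforces : ∀ d d' z, p.Forces d d' z → overlap r q ≤ val d * z * star (val d') := by
    intro d d' z hz
    rw [hval_ne hz.left_ne_zero, hval_ne hz.right_ne_zero]
    calc overlap r q ≤ r * p.base * star r := hbase
      _ ≤ r * (p.val d * z * star (p.val d')) * star r := by gcongr; exact hz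
      _ = r * p.val d * z * star (r * p.val d') := by simp only [star_mul, mul_assoc]
  have hleft : overlap r q ≤ val a * x * star (val c) := by
    rw [hval_self, hval_ne h.left_ne_zero, mul_assoc r]
    exact overlap_le_of_le (hle'.trans inf_le_left)
  have hright : overlap r q ≤ val c * y * star (val b) := by
    rw [hval_self, hval_ne h.right_ne_zero, star_mul, ← mul_assoc, mul_assoc q]
    apply overlap_le_of_le_star
    simpa using hle'.trans inf_le_right
  have hupper : p.Forces .source .target w := p.le_upper
  refine ⟨⟨overlap r q, val, overlap_ne_zero hne, overlap_le_one, ?_, hforces _ _ _ hupper,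
    ?_, ?_⟩, hforces, hleft, hright⟩
  · intro d
    by_cases hd : d = c
    · rwa [hd, hval_self]
    · rw [hval, Function.update_of_ne hd]
      exact functional_mul hr (p.functional d)
  · rw [hval_ne hupper.left_ne_zero, hval_ne hupper.right_ne_zero]
    apply eq_zero_of_le
    calc overlap r q ⊓ r * p.val .source * v * star (r * p.val .target)
        ≤ r * p.base * star r ⊓ r * (p.val .source * v * star (p.val .target)) * star r :=
          inf_le_inf hbase (by simp only [star_mul, mul_assoc, le_refl])
      _ ≤ r * (p.base ⊓ p.val .source * v * star (p.val .target)) * star r :=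
          conjugate_inf_le hr hr _ _
      _ = 0 := by rw [p.disjoint_lower, mul_zero, zero_mul]
  · intro a' b' x' y' hd
    by_cases hdc : PointName.witness a' b' x' y' = c
    · obtain ⟨rfl, rfl, rfl, rfl⟩ := PointName.witness.inj (hdc.trans hc)
      exact ⟨hleft, hright⟩
    · rw [hval, Function.update_of_ne hdc] at hd
      have := p.le_witness a' b' x' y' (right_ne_zero_of_mul hd)
      exact ⟨hforces _ _ _ this.1, hforces _ _ _ this.2⟩

theorem nonempty_of_tabular (hTab : J.Tabular) (hvw : v ≤ w) (hne : v ≠ w) :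
    Nonempty (Condition J v w) := by
  obtain ⟨r, q, hr, hq, hrq, hle, hdisj⟩ := hTab v w hvw hne
  change J.Carrier at r q
  change star r * r ≤ 1 at hr
  change star q * q ≤ 1 at hq
  refine ⟨overlap r q, fun | .source => r | .target => q | .witness .. => 0,
    overlap_ne_zero hrq, overlap_le_one, ?_, overlap_le_of_le hle,
    overlap_inf_eq_zero hdisj, fun _ _ _ _ h => absurd rfl h⟩
  rintro (_ | _ | _)
  · exact hr
  · exact hq
  · simpa using zero_le 1

/-- The pairs of names that are generically related by `x`. -/
def genericRel (v w x : J.Carrier) : Set (PointName A × PointName A) :=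
  {d | ∀ p : Condition J v w, ∃ p' ≤ p, p'.Forces d.1 d.2 x}

end Condition

end JAlgebra

open JAlgebra Condition

/-- Key lemma: in a tabular J-algebra, any pair v < w can be separated by a
representation-like map ρ into binary relations on some set U. -/
theorem separating_relational_map {A : Type u} (J : JAlgebra A)
    (hTab : J.Tabular) (v w : A) (hvw : J.meet v w = v) (hne : v ≠ w) :
    ∃ (U : Type u) (ρ : A → Set (U × U)),
      ρ v ≠ ρ w ∧
      ρ J.zero = (∅ : Set (U × U)) ∧
      (∀ x y : A, ρ (J.meet x y) = ρ x ∩ ρ y) ∧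
      (∀ x y : A, ρ (J.comp x y) =
        {p : U × U | ∃ z : U, (p.1, z) ∈ ρ x ∧ (z, p.2) ∈ ρ y}) ∧
      (∀ x : A, ρ (J.conv x) = {p : U × U | (p.2, p.1) ∈ ρ x}) := by
  change J.Carrier at v w
  obtain ⟨p₀⟩ := nonempty_of_tabular hTab hvw hne
  refine ⟨PointName A, fun x => genericRel (J := J) v w x, ?_, ?_, ?_, ?_, ?_⟩
  · intro h
    have hw : (PointName.source, PointName.target) ∈ genericRel v w w :=
      fun p => ⟨p, le_rfl, p.le_upper⟩
    change genericRel v w v = genericRel v w w at h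
    rw [← h] at hw
    obtain ⟨p, -, hp⟩ := hw p₀
    exact not_forces_lower hp
  · refine Set.eq_empty_of_forall_notMem fun d hd => ?_
    obtain ⟨p, -, hp⟩ := hd p₀
    exact not_forces_zero hp
  · intro x y
    change J.Carrier at x y
    ext d
    constructor
    · refine fun h => ⟨fun p => ?_, fun p => ?_⟩ <;> obtain ⟨p', hp', hf⟩ := h p
      · exact ⟨p', hp', hf.mono inf_le_left⟩
      · exact ⟨p', hp', hf.mono inf_le_right⟩
    · rintro ⟨hx, hy⟩ p
      obtain ⟨p₁, hp₁, hx₁⟩ := hx p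
      obtain ⟨p₂, hp₂, hy₂⟩ := hy p₁
      exact ⟨p₂, hp₂.trans hp₁, (hp₂ _ _ _ hx₁).inf hy₂⟩
  · intro x y
    change J.Carrier at x y
    ext d
    constructor
    · refine fun h => ⟨.witness d.1 d.2 x y, fun p => ?_, fun p => ?_⟩ <;>
        obtain ⟨p₁, hp₁, hf⟩ := h p <;>
        obtain ⟨p₂, hp₂, hx, hy⟩ := p₁.exists_le_forces_witness hTab hf
      · exact ⟨p₂, hp₂.trans hp₁, hx⟩
      · exact ⟨p₂, hp₂.trans hp₁, hy⟩
    · rintro ⟨c, hx, hy⟩ p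
      obtain ⟨p₁, hp₁, hx₁⟩ := hx p
      obtain ⟨p₂, hp₂, hy₂⟩ := hy p₁
      exact ⟨p₂, hp₂.trans hp₁, (hp₂ _ _ _ hx₁).mul hy₂⟩
  · intro x
    change J.Carrier at x
    have hstar : ∀ {a b x}, (a, b) ∈ genericRel v w x → (b, a) ∈ genericRel v w (star x) :=
      fun h p => (h p).imp fun _ hp' => ⟨hp'.1, hp'.2.star⟩
    ext d
    exact ⟨fun h => star_star x ▸ hstar (x := star x) h, hstar⟩
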